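/- Let d ∈ ℕ, let b₁,…,b_d ∈ C³([0,1]^d,ℝ) satisfy for all i ∈ {1,…,d} and all x = (x₁,…,x_d) ∈ [0,1]^d with x_i ∈ {0,1} that (−1)^{x_i} b_i(x) ≥ 0, and let y be the associated flow. Assume additionally (as follows from standard ODE theory) that for every t ∈ [0,∞) the map x ↦ y(t,x) is three times continuously differentiable on [0,1]^d with all partial derivatives up to order three jointly continuous in (t,x). Then for every f ∈ C³([0,1]^d,ℝ) and every t ∈ [0,∞) it holds that T¹_t f ∈ C³([0,1]^d,ℝ) and ‖T¹_t f‖_{C³} ≤ e^{13 λ₃ t} ‖f‖_{C³}. -/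

import Mathlib

open MeasureTheory Filter

noncomputable section

/-- The unit cube `[0,1]^d` in `ℝ^d`. -/
def cube (d : ℕ) : Set (Fin d → ℝ) := Set.univ.pi fun _ => Set.Icc (0:ℝ) 1

/-- Partial derivative in coordinate `i` (within `[0,1]`, i.e. one-sided at the boundary). -/
def pd (d : ℕ) (i : Fin d) (g : (Fin d → ℝ) → ℝ) : (Fin d → ℝ) → ℝ :=
  fun x => derivWithin (fun t => g (Function.update x i t)) (Set.Icc (0:ℝ) 1) (x i)

/-- Iterated partial derivative `∂^α` (coordinates applied in a fixed order). -/
def mderiv (d : ℕ) (α : Fin d → ℕ) (f : (Fin d → ℝ) → ℝ) : (Fin d → ℝ) → ℝ :=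
  List.foldr (fun i g => (pd d i)^[α i] g) f (List.finRange d)

/-- `f ∈ C^m([0,1]^d, ℝ)`: all partial derivatives of order `0` through `m` exist
(one-sidedly at the boundary) and are continuous on the cube. -/
def MemCm (d : ℕ) : ℕ → ((Fin d → ℝ) → ℝ) → Prop
  | 0, f => ContinuousOn f (cube d)
  | m + 1, f => ContinuousOn f (cube d) ∧ ∀ i : Fin d,
      (∀ x ∈ cube d, DifferentiableWithinAt ℝ (fun t => f (Function.update x i t))
        (Set.Icc (0:ℝ) 1) (x i)) ∧
      MemCm d m (pd d i f)

/-- Sup norm over the cube: `‖g‖_∞ = sup_{x ∈ [0,1]^d} |g(x)|`. -/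
def supCube (d : ℕ) (g : (Fin d → ℝ) → ℝ) : ℝ := ⨆ x : cube d, |g x.1|

/-- The `C^m`-norm: `max_{|α| ≤ m} sup_{x ∈ [0,1]^d} |∂^α f(x)|`. -/
def CmNorm (d m : ℕ) (f : (Fin d → ℝ) → ℝ) : ℝ :=
  ⨆ α : {α : Fin d → ℕ // (∑ i, α i) ≤ m}, supCube d (mderiv d α.1 f)

/-- `λ_m := max_{0 < |α| ≤ m} ∑_i ‖∂^α b_i‖_∞`. -/
def lamNorm (d m : ℕ) (b : Fin d → (Fin d → ℝ) → ℝ) : ℝ :=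
  ⨆ α : {α : Fin d → ℕ // 0 < (∑ i, α i) ∧ (∑ i, α i) ≤ m},
    ∑ i, supCube d (mderiv d α.1 (b i))

section Cube

variable {d : ℕ}

theorem update_mem_cube {x : Fin d → ℝ} (hx : x ∈ cube d) (i : Fin d) {t : ℝ}
    (ht : t ∈ Set.Icc (0:ℝ) 1) : Function.update x i t ∈ cube d := by
  intro j _
  by_cases h : j = i
  · subst h; simpa using ht
  · simpa [h] using hx j trivial

theorem apply_mem_Icc {x : Fin d → ℝ} (hx : x ∈ cube d) (i : Fin d) :
    x i ∈ Set.Icc (0:ℝ) 1 := hx i trivial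

theorem isCompact_cube : IsCompact (cube d) := isCompact_univ_pi fun _ => isCompact_Icc

theorem convex_cube : Convex ℝ (cube d) := convex_pi fun _ _ => convex_Icc 0 1

theorem zero_mem_cube : (0 : Fin d → ℝ) ∈ cube d := fun _ _ => by simp

instance : Nonempty (cube d) := ⟨⟨0, zero_mem_cube⟩⟩

theorem interior_cube_nonempty : (interior (cube d)).Nonempty := by
  refine ⟨fun _ => 1 / 2, ?_⟩
  rw [cube, interior_pi_set Set.finite_univ]
  intro i _
  rw [interior_Icc]
  constructor <;> norm_num

theorem pd_eq_of_hasDerivWithinAt {i : Fin d} {f : (Fin d → ℝ) → ℝ} {x : Fin d → ℝ} {D : ℝ}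
    (hx : x ∈ cube d)
    (h : HasDerivWithinAt (fun t => f (Function.update x i t)) D (Set.Icc (0:ℝ) 1) (x i)) :
    pd d i f x = D :=
  h.derivWithin (uniqueDiffOn_Icc zero_lt_one _ (apply_mem_Icc hx i))

theorem Set.EqOn.pd {f g : (Fin d → ℝ) → ℝ} (h : Set.EqOn f g (cube d)) (i : Fin d) :
    Set.EqOn (pd d i f) (pd d i g) (cube d) := fun _ hx =>
  derivWithin_congr (fun _ ht => h (update_mem_cube hx i ht))
    (h (update_mem_cube hx i (apply_mem_Icc hx i)))

theorem MemCm.continuousOn {m : ℕ} {f : (Fin d → ℝ) → ℝ} (hf : MemCm d m f) :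
    ContinuousOn f (cube d) := by
  cases m with
  | zero => exact hf
  | succ m => exact hf.1

theorem MemCm.of_succ {m : ℕ} {f : (Fin d → ℝ) → ℝ} (hf : MemCm d (m + 1) f) : MemCm d m f := by
  induction m generalizing f with
  | zero => exact hf.1
  | succ m ih => exact ⟨hf.1, fun i => ⟨(hf.2 i).1, ih (hf.2 i).2⟩⟩

theorem MemCm.mono {m n : ℕ} (hmn : m ≤ n) {f : (Fin d → ℝ) → ℝ} (hf : MemCm d n f) :
    MemCm d m f := by
  induction hmn with
  | refl => exact hf
  | step _ ih => exact ih hf.of_succ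

theorem MemCm.congr {m : ℕ} {f g : (Fin d → ℝ) → ℝ} (hf : MemCm d m f)
    (h : Set.EqOn f g (cube d)) : MemCm d m g := by
  induction m generalizing f g with
  | zero => exact ContinuousOn.congr hf h.symm
  | succ m ih =>
    refine ⟨hf.1.congr h.symm, fun i => ⟨fun x hx => ?_, ih (hf.2 i).2 (h.pd i)⟩⟩
    exact ((hf.2 i).1 x hx).congr (fun t ht => (h (update_mem_cube hx i ht)).symm)
      (h (update_mem_cube hx i (apply_mem_Icc hx i))).symm

theorem MemCm.hasDerivWithinAt {m : ℕ} {f : (Fin d → ℝ) → ℝ} (hf : MemCm d (m + 1) f) (i : Fin d)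
    {x : Fin d → ℝ} (hx : x ∈ cube d) :
    HasDerivWithinAt (fun t => f (Function.update x i t)) (pd d i f x) (Set.Icc (0:ℝ) 1) (x i) :=
  ((hf.2 i).1 x hx).hasDerivWithinAt

theorem pd_const (i : Fin d) (c : ℝ) : pd d i (fun _ => c) = fun _ => 0 := by
  funext x; simp [pd]

theorem memCm_const (m : ℕ) (c : ℝ) : MemCm d m (fun _ => c) := by
  induction m generalizing c with
  | zero => exact continuousOn_const
  | succ m ih =>
    refine ⟨continuousOn_const, fun i => ⟨fun _ _ => differentiableWithinAt_const c, ?_⟩⟩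
    rw [pd_const]
    exact ih 0

theorem eqOn_pd_apply (i j : Fin d) :
    Set.EqOn (pd d j (fun x => x i)) (fun _ => if i = j then 1 else 0) (cube d) := by
  intro x hx
  apply pd_eq_of_hasDerivWithinAt hx
  by_cases h : i = j
  · subst h; simpa using (hasDerivAt_id' (x i)).hasDerivWithinAt (s := Set.Icc 0 1)
  · simpa [h] using hasDerivWithinAt_const _ _ _

theorem memCm_apply (m : ℕ) (i : Fin d) : MemCm d m (fun x => x i) := by
  cases m with
  | zero => exact (continuous_apply i).continuousOn
  | succ m =>
    refine ⟨(continuous_apply i).continuousOn, fun j => ⟨fun x _ => ?_,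
      (memCm_const m _).congr (eqOn_pd_apply i j).symm⟩⟩
    by_cases h : i = j
    · subst h; simpa using differentiableWithinAt_fun_id
    · simpa [h] using differentiableWithinAt_const _

/-- Continuous partial derivatives on the cube give Fréchet differentiability. -/
theorem MemCm.hasFDerivWithinAt {m : ℕ} {f : (Fin d → ℝ) → ℝ} (hf : MemCm d (m + 1) f)
    {x : Fin d → ℝ} (hx : x ∈ cube d) :
    HasFDerivWithinAt f (∑ i, pd d i f x • ContinuousLinearMap.proj (R := ℝ) (φ := fun _ => ℝ) i)
      (cube d) x := by
  rw [hasFDerivWithinAt_iff_isLittleO, Asymptotics.isLittleO_iff]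
  intro c hc
  obtain ⟨ε, hε, hεc⟩ : ∃ ε > 0, ε * d ≤ c := by
    refine ⟨c / (d + 1), by positivity, ?_⟩
    rw [div_mul_eq_mul_div, div_le_iff₀ (by positivity)]
    nlinarith
  have hev : ∀ᶠ z in nhdsWithin x (cube d), ∀ i, |pd d i f z - pd d i f x| ≤ ε := by
    rw [eventually_all]
    intro i
    have h := (hf.2 i).2.continuousOn x hx
    filter_upwards [h.eventually (Metric.closedBall_mem_nhds _ hε)] with z hz
    simpa [Real.dist_eq] using hz
  rw [eventually_nhdsWithin_iff, Metric.eventually_nhds_iff] at hev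
  obtain ⟨r, hr, hball⟩ := hev
  rw [eventually_nhdsWithin_iff, Metric.eventually_nhds_iff]
  refine ⟨r, hr, fun z hzr hz => ?_⟩
  have key (S : Finset (Fin d)) : S.piecewise z x ∈ cube d ∧ dist (S.piecewise z x) x < r ∧
      |f (S.piecewise z x) - f x - ∑ i ∈ S, pd d i f x * (z i - x i)|
        ≤ ∑ i ∈ S, ε * |z i - x i| := by
    have hmem (S : Finset (Fin d)) : S.piecewise z x ∈ cube d := by
      intro i _
      by_cases h : i ∈ S <;> simp only [h, Finset.piecewise_eq_of_mem,
        Finset.piecewise_eq_of_notMem, not_false_eq_true]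
      · exact hz i trivial
      · exact hx i trivial
    refine ⟨hmem S, ?_, ?_⟩
    · rw [dist_pi_lt_iff hr]
      intro i
      by_cases h : i ∈ S <;> simp only [h, Finset.piecewise_eq_of_mem,
        Finset.piecewise_eq_of_notMem, not_false_eq_true]
      · exact (dist_le_pi_dist z x i).trans_lt hzr
      · simpa using hr
    · induction S using Finset.induction_on with
      | empty => simp
      | insert i S hi ih =>
        rw [Finset.sum_insert hi, Finset.sum_insert hi, Finset.piecewise_insert]
        set w := S.piecewise z x with hw
        have hwi : w i = x i := by simp [hw, hi]
        have hseg : Set.uIcc (x i) (z i) ⊆ Set.Icc (0:ℝ) 1 :=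
          Set.uIcc_subset_Icc (hx i trivial) (hz i trivial)
        have hstep : ‖(f (Function.update w i (z i)) - pd d i f x * z i) -
            (f (Function.update w i (x i)) - pd d i f x * x i)‖ ≤ ε * ‖z i - x i‖ := by
          refine Convex.norm_image_sub_le_of_norm_hasDerivWithin_le (s := Set.uIcc (x i) (z i))
            (f := fun t => f (Function.update w i t) - pd d i f x * t)
            (f' := fun t => pd d i f (Function.update w i t) - pd d i f x) ?_ ?_
            (convex_uIcc _ _) Set.left_mem_uIcc Set.right_mem_uIcc
          · intro t ht
            have h1 := hf.hasDerivWithinAt i (update_mem_cube (hmem S) i (hseg ht))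
            simp only [Function.update_idem, Function.update_self] at h1
            exact (h1.mono hseg).sub
              (by simpa using ((hasDerivAt_id t).const_mul (pd d i f x)).hasDerivWithinAt)
          · intro t ht
            refine hball ?_ (update_mem_cube (hmem S) i (hseg ht)) i
            rw [dist_pi_lt_iff hr]
            intro j
            by_cases hj : j = i
            · subst hj
              rw [Function.update_self]
              calc dist t (x j) ≤ dist (z j) (x j) := by
                    rw [dist_comm t, dist_comm (z j)]
                    exact Real.dist_left_le_of_mem_uIcc ht
                _ < r := (dist_le_pi_dist z x j).trans_lt hzr
            · rw [Function.update_of_ne hj]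
              by_cases h : j ∈ S <;> simp only [h, Finset.piecewise_eq_of_mem,
                Finset.piecewise_eq_of_notMem, not_false_eq_true]
              · exact (dist_le_pi_dist z x j).trans_lt hzr
              · simpa using hr
        have hupd : Function.update w i (x i) = w := by rw [← hwi, Function.update_eq_self]
        rw [hupd, Real.norm_eq_abs, Real.norm_eq_abs] at hstep
        calc _ = |((f (Function.update w i (z i)) - pd d i f x * z i) - (f w - pd d i f x * x i)) +
              (f w - f x - ∑ i ∈ S, pd d i f x * (z i - x i))| := by congr 1; ring
          _ ≤ _ := (abs_add_le _ _).trans (add_le_add hstep ih)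
  have h := (key Finset.univ).2.2
  simp only [Finset.piecewise_univ] at h
  simp only [_root_.sum_apply, _root_.smul_apply,
    ContinuousLinearMap.proj_apply, smul_eq_mul, Pi.sub_apply, Real.norm_eq_abs]
  refine h.trans ?_
  calc ∑ i, ε * |z i - x i| ≤ ∑ _i : Fin d, ε * ‖z - x‖ := by
        gcongr with i
        exact norm_le_pi_norm (z - x) i
    _ = ε * d * ‖z - x‖ := by simp; ring
    _ ≤ c * ‖z - x‖ := by gcongr

/-- Symmetry of second partial derivatives on the cube, including its boundary. -/
theorem MemCm.pd_comm {f : (Fin d → ℝ) → ℝ} (hf : MemCm d 2 f) (i j : Fin d) :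
    Set.EqOn (pd d i (pd d j f)) (pd d j (pd d i f)) (cube d) := by
  intro x hx
  have h1 : ∀ z ∈ interior (cube d), HasFDerivAt f
      (∑ i, pd d i f z • ContinuousLinearMap.proj (R := ℝ) (φ := fun _ => ℝ) i) z := fun z hz =>
    (hf.hasFDerivWithinAt (interior_subset hz)).hasFDerivAt (mem_interior_iff_mem_nhds.1 hz)
  have h2 : HasFDerivWithinAt
      (fun z => ∑ i, pd d i f z • ContinuousLinearMap.proj (R := ℝ) (φ := fun _ => ℝ) i)
      (∑ i, (∑ k, pd d k (pd d i f) x •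
        ContinuousLinearMap.proj (R := ℝ) (φ := fun _ => ℝ) k).smulRight
          (ContinuousLinearMap.proj (R := ℝ) (φ := fun _ => ℝ) i)) (interior (cube d)) x := by
    refine HasFDerivWithinAt.fun_sum fun i _ => ?_
    exact HasFDerivWithinAt.smul_const (𝕜 := ℝ) (𝕜' := ℝ)
      (((hf.2 i).2.hasFDerivWithinAt hx).mono interior_subset)
      (ContinuousLinearMap.proj (R := ℝ) (φ := fun _ => ℝ) i)
  have h3 := convex_cube.second_derivative_within_at_symmetric interior_cube_nonempty h1 hx h2
    (Pi.single i 1) (Pi.single j 1)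
  simpa [_root_.sum_apply, Pi.single_apply] using h3

/-- Chain rule for partial derivatives on the cube. -/
theorem MemCm.hasDerivWithinAt_comp {m n : ℕ} {g : (Fin d → ℝ) → ℝ} (hg : MemCm d (m + 1) g)
    {φ : (Fin d → ℝ) → (Fin d → ℝ)} (hφ : ∀ k, MemCm d (n + 1) (fun x => φ x k))
    (hmaps : ∀ x ∈ cube d, φ x ∈ cube d) (j : Fin d) {x : Fin d → ℝ} (hx : x ∈ cube d) :
    HasDerivWithinAt (fun t => g (φ (Function.update x j t)))
      (∑ l, pd d l g (φ x) * pd d j (fun x => φ x l) x) (Set.Icc (0:ℝ) 1) (x j) := by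
  have h1 := hg.hasFDerivWithinAt (hmaps x hx)
  have h2 : HasDerivWithinAt (fun t => φ (Function.update x j t))
      (fun l => pd d j (fun x => φ x l) x) (Set.Icc (0:ℝ) 1) (x j) :=
    hasDerivWithinAt_pi.2 fun l => (hφ l).hasDerivWithinAt j hx
  have h3 := HasFDerivWithinAt.comp_hasDerivWithinAt (l := g) (t := cube d) (x j)
    (by simpa using h1) h2 (fun t ht => hmaps _ (update_mem_cube hx j ht))
  simpa [_root_.sum_apply, Function.comp_def] using h3

theorem MemCm.pd_comp {m n : ℕ} {g : (Fin d → ℝ) → ℝ} (hg : MemCm d (m + 1) g)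
    {φ : (Fin d → ℝ) → (Fin d → ℝ)} (hφ : ∀ k, MemCm d (n + 1) (fun x => φ x k))
    (hmaps : ∀ x ∈ cube d, φ x ∈ cube d) (j : Fin d) :
    Set.EqOn (pd d j (fun x => g (φ x)))
      (fun x => ∑ l, pd d l g (φ x) * pd d j (fun x => φ x l) x) (cube d) := fun _ hx =>
  pd_eq_of_hasDerivWithinAt hx (hg.hasDerivWithinAt_comp hφ hmaps j hx)

end Cube

section IterPd

variable {d : ℕ}

/-- Iterated partial derivatives along a list of coordinates (the last entry is applied first). -/
def iterPd (d : ℕ) (L : List (Fin d)) (f : (Fin d → ℝ) → ℝ) : (Fin d → ℝ) → ℝ :=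
  L.foldr (pd d) f

theorem MemCm.iterPd {m : ℕ} (L : List (Fin d)) {f : (Fin d → ℝ) → ℝ}
    (hf : MemCm d (m + L.length) f) : MemCm d m (iterPd d L f) := by
  induction L generalizing m with
  | nil => exact hf
  | cons i L ih =>
    refine ((ih (m := m + 1) ?_).2 i).2
    rwa [List.length_cons, ← add_assoc, add_right_comm] at hf

theorem MemCm.iterPd_perm {L L' : List (Fin d)} (h : L.Perm L') {f : (Fin d → ℝ) → ℝ}
    (hf : MemCm d L.length f) : Set.EqOn (_root_.iterPd d L f) (_root_.iterPd d L' f) (cube d) := by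
  induction h with
  | nil => exact fun _ _ => rfl
  | cons i _ ih => exact (ih hf.of_succ).pd i
  | swap i j L =>
    refine MemCm.pd_comm (MemCm.iterPd L ?_) j i
    exact hf.mono (by simp; omega)
  | trans h₁ _ ih₁ ih₂ => exact (ih₁ hf).trans (ih₂ (h₁.length_eq ▸ hf))

theorem mderiv_eq_iterPd (α : Fin d → ℕ) (f : (Fin d → ℝ) → ℝ) :
    mderiv d α f = iterPd d ((List.finRange d).flatMap fun i => List.replicate (α i) i) f := by
  have hrep (n : ℕ) (i : Fin d) (g : (Fin d → ℝ) → ℝ) :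
      (pd d i)^[n] g = (List.replicate n i).foldr (pd d) g := by
    induction n with
    | zero => rfl
    | succ n ih => rw [Function.iterate_succ_apply', ih, List.replicate_succ, List.foldr_cons]
  unfold mderiv iterPd
  induction List.finRange d with
  | nil => rfl
  | cons i l ih => rw [List.foldr_cons, ih, List.flatMap_cons, List.foldr_append, hrep]

theorem length_flatMap_replicate (α : Fin d → ℕ) :
    ((List.finRange d).flatMap fun i => List.replicate (α i) i).length = ∑ i, α i := by
  simp [List.length_flatMap, Fin.sum_univ_def]

theorem sum_count_eq_length (L : List (Fin d)) : ∑ i, L.count i = L.length := by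
  simpa using Multiset.sum_count_eq_card (s := Finset.univ) (m := (L : Multiset (Fin d)))
    fun _ _ => Finset.mem_univ _

theorem MemCm.mderiv_count_eqOn {L : List (Fin d)} {f : (Fin d → ℝ) → ℝ}
    (hf : MemCm d L.length f) :
    Set.EqOn (mderiv d (fun i => L.count i) f) (_root_.iterPd d L f) (cube d) := by
  rw [mderiv_eq_iterPd]
  refine (MemCm.iterPd_perm ?_ hf).symm
  rw [List.perm_iff_count]
  intro i
  rw [List.count_flatMap]
  simp [Function.comp_def, List.count_replicate, ← Fin.sum_univ_def]

theorem abs_le_supCube {g : (Fin d → ℝ) → ℝ} (hg : ContinuousOn g (cube d)) {x : Fin d → ℝ}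
    (hx : x ∈ cube d) : |g x| ≤ supCube d g := by
  obtain ⟨C, hC⟩ := isCompact_cube.exists_bound_of_continuousOn hg
  exact le_ciSup (f := fun x : cube d => |g x.1|)
    ⟨C, by rintro _ ⟨z, rfl⟩; exact hC z.1 z.2⟩ ⟨x, hx⟩

theorem supCube_nonneg (g : (Fin d → ℝ) → ℝ) : 0 ≤ supCube d g :=
  Real.iSup_nonneg fun _ => abs_nonneg _

theorem finite_multiindex (m : ℕ) : Finite {α : Fin d → ℕ // ∑ i, α i ≤ m} := by
  refine Set.Finite.to_subtype ((Set.finite_Icc (0 : Fin d → ℕ) (fun _ => m)).subset ?_)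
  intro α hα
  exact ⟨fun i => Nat.zero_le _, fun i => (Finset.single_le_sum (f := α)
    (fun _ _ => Nat.zero_le _) (Finset.mem_univ i)).trans hα⟩

theorem CmNorm_nonneg (m : ℕ) (f : (Fin d → ℝ) → ℝ) : 0 ≤ CmNorm d m f :=
  Real.iSup_nonneg fun _ => supCube_nonneg _

theorem lamNorm_nonneg (m : ℕ) (b : Fin d → (Fin d → ℝ) → ℝ) : 0 ≤ lamNorm d m b :=
  Real.iSup_nonneg fun _ => Finset.sum_nonneg fun _ _ => supCube_nonneg _

theorem MemCm.abs_iterPd_le_supCube {L : List (Fin d)} {f : (Fin d → ℝ) → ℝ}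
    (hf : MemCm d L.length f) {x : Fin d → ℝ} (hx : x ∈ cube d) :
    |_root_.iterPd d L f x| ≤ supCube d (mderiv d (fun i => L.count i) f) := by
  rw [← hf.mderiv_count_eqOn hx]
  refine abs_le_supCube (ContinuousOn.congr ?_ hf.mderiv_count_eqOn) hx
  exact (MemCm.iterPd (m := 0) L (by rwa [zero_add])).continuousOn

theorem MemCm.abs_iterPd_le_CmNorm {m : ℕ} {L : List (Fin d)} (hL : L.length ≤ m)
    {f : (Fin d → ℝ) → ℝ} (hf : MemCm d m f) {x : Fin d → ℝ} (hx : x ∈ cube d) :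
    |_root_.iterPd d L f x| ≤ CmNorm d m f := by
  refine ((hf.mono hL).abs_iterPd_le_supCube hx).trans ?_
  have := finite_multiindex (d := d) m
  exact le_ciSup (f := fun α : {α : Fin d → ℕ // ∑ i, α i ≤ m} => supCube d (mderiv d α.1 f))
    (Set.finite_range _).bddAbove ⟨fun i => L.count i, by rwa [sum_count_eq_length]⟩

theorem sum_abs_iterPd_le_lamNorm {m : ℕ} {L : List (Fin d)} (hL₀ : 0 < L.length)
    (hL : L.length ≤ m) {b : Fin d → (Fin d → ℝ) → ℝ} (hb : ∀ i, MemCm d m (b i))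
    {x : Fin d → ℝ} (hx : x ∈ cube d) :
    ∑ i, |iterPd d L (b i) x| ≤ lamNorm d m b := by
  refine (Finset.sum_le_sum fun i _ => ((hb i).mono hL).abs_iterPd_le_supCube hx).trans ?_
  have := finite_multiindex (d := d) m
  have : Finite {α : Fin d → ℕ // 0 < (∑ i, α i) ∧ (∑ i, α i) ≤ m} :=
    Finite.of_injective (fun α => (⟨α.1, α.2.2⟩ : {α : Fin d → ℕ // ∑ i, α i ≤ m}))
      fun α β h => Subtype.ext (by simpa using h)
  exact le_ciSup (f := fun α : {α : Fin d → ℕ // 0 < (∑ i, α i) ∧ (∑ i, α i) ≤ m} =>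
    ∑ i, supCube d (mderiv d α.1 (b i))) (Set.finite_range _).bddAbove
    ⟨fun i => L.count i, by rw [sum_count_eq_length]; exact ⟨hL₀, hL⟩⟩

theorem CmNorm_le {m : ℕ} {f : (Fin d → ℝ) → ℝ} {C : ℝ}
    (h : ∀ L : List (Fin d), L.length ≤ m → ∀ x ∈ cube d, |iterPd d L f x| ≤ C) :
    CmNorm d m f ≤ C := by
  have : Nonempty {α : Fin d → ℕ // ∑ i, α i ≤ m} := ⟨⟨0, by simp⟩⟩
  refine ciSup_le fun α => ciSup_le fun x => ?_
  rw [mderiv_eq_iterPd]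
  exact h _ ((length_flatMap_replicate α.1).trans_le α.2) x x.2

end IterPd

section JointCm

variable {d : ℕ}

/-- Time-dependent functions on the cube all of whose spatial partial derivatives up to order `m`
exist and are jointly continuous in time and space. -/
def JointCm (d : ℕ) : ℕ → (ℝ → (Fin d → ℝ) → ℝ) → Prop
  | 0, G => ContinuousOn (fun q : ℝ × (Fin d → ℝ) => G q.1 q.2) (Set.Ici (0:ℝ) ×ˢ cube d)
  | m + 1, G => ContinuousOn (fun q : ℝ × (Fin d → ℝ) => G q.1 q.2) (Set.Ici (0:ℝ) ×ˢ cube d) ∧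
      ∀ i : Fin d, (∀ t ∈ Set.Ici (0:ℝ), ∀ x ∈ cube d,
        DifferentiableWithinAt ℝ (fun s => G t (Function.update x i s)) (Set.Icc (0:ℝ) 1) (x i)) ∧
      JointCm d m (fun t => pd d i (G t))

namespace JointCm

theorem continuousOn {m : ℕ} {G : ℝ → (Fin d → ℝ) → ℝ} (hG : JointCm d m G) :
    ContinuousOn (fun q : ℝ × (Fin d → ℝ) => G q.1 q.2) (Set.Ici (0:ℝ) ×ˢ cube d) := by
  cases m with
  | zero => exact hG
  | succ m => exact hG.1

theorem continuousOn_time {m : ℕ} {G : ℝ → (Fin d → ℝ) → ℝ} (hG : JointCm d m G)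
    {x : Fin d → ℝ} (hx : x ∈ cube d) : ContinuousOn (fun t => G t x) (Set.Ici 0) :=
  hG.continuousOn.comp (f := fun t : ℝ => (t, x)) (by fun_prop) fun _ ht => ⟨ht, hx⟩

theorem memCm {m : ℕ} {G : ℝ → (Fin d → ℝ) → ℝ} (hG : JointCm d m G) {t : ℝ} (ht : 0 ≤ t) :
    MemCm d m (G t) := by
  have hcont {m : ℕ} {G : ℝ → (Fin d → ℝ) → ℝ} (hG : JointCm d m G) :
      ContinuousOn (G t) (cube d) :=
    hG.continuousOn.comp (f := fun x : Fin d → ℝ => (t, x)) (by fun_prop) fun _ hx => ⟨ht, hx⟩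
  induction m generalizing G with
  | zero => exact hcont hG
  | succ m ih => exact ⟨hcont hG, fun i => ⟨(hG.2 i).1 t ht, ih (hG.2 i).2⟩⟩

theorem of_succ {m : ℕ} {G : ℝ → (Fin d → ℝ) → ℝ} (hG : JointCm d (m + 1) G) : JointCm d m G := by
  induction m generalizing G with
  | zero => exact hG.1
  | succ m ih => exact ⟨hG.1, fun i => ⟨(hG.2 i).1, ih (hG.2 i).2⟩⟩

theorem mono {m n : ℕ} (hmn : m ≤ n) {G : ℝ → (Fin d → ℝ) → ℝ} (hG : JointCm d n G) :
    JointCm d m G := by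
  induction hmn with
  | refl => exact hG
  | step _ ih => exact ih hG.of_succ

theorem congr {m : ℕ} {G H : ℝ → (Fin d → ℝ) → ℝ} (hG : JointCm d m G)
    (h : ∀ t, 0 ≤ t → Set.EqOn (G t) (H t) (cube d)) : JointCm d m H := by
  have hcont {m : ℕ} {G H : ℝ → (Fin d → ℝ) → ℝ} (hG : JointCm d m G)
      (h : ∀ t, 0 ≤ t → Set.EqOn (G t) (H t) (cube d)) :=
    hG.continuousOn.congr (g := fun q : ℝ × (Fin d → ℝ) => H q.1 q.2)
      fun q hq => (h q.1 hq.1 hq.2).symm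
  induction m generalizing G H with
  | zero => exact hcont hG h
  | succ m ih =>
    refine ⟨hcont hG h, fun i => ⟨fun t ht x hx => ?_, ih (hG.2 i).2 fun t ht => (h t ht).pd i⟩⟩
    exact ((hG.2 i).1 t ht x hx).congr (fun s hs => (h t ht (update_mem_cube hx i hs)).symm)
      (h t ht (update_mem_cube hx i (apply_mem_Icc hx i))).symm

theorem of_hasDerivWithinAt {m : ℕ} {G : ℝ → (Fin d → ℝ) → ℝ} {G' : Fin d → ℝ → (Fin d → ℝ) → ℝ}
    (hG : JointCm d 0 G) (hG' : ∀ i, JointCm d m (G' i))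
    (h : ∀ i, ∀ t, 0 ≤ t → ∀ x ∈ cube d, HasDerivWithinAt (fun s => G t (Function.update x i s))
      (G' i t x) (Set.Icc (0:ℝ) 1) (x i)) : JointCm d (m + 1) G :=
  ⟨hG, fun i => ⟨fun t ht x hx => (h i t ht x hx).differentiableWithinAt,
    (hG' i).congr fun t ht x hx => (pd_eq_of_hasDerivWithinAt hx (h i t ht x hx)).symm⟩⟩

theorem hasDerivWithinAt {m : ℕ} {G : ℝ → (Fin d → ℝ) → ℝ} (hG : JointCm d (m + 1) G) (i : Fin d)
    {t : ℝ} (ht : 0 ≤ t) {x : Fin d → ℝ} (hx : x ∈ cube d) :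
    HasDerivWithinAt (fun s => G t (Function.update x i s)) (pd d i (G t) x)
      (Set.Icc (0:ℝ) 1) (x i) :=
  (hG.memCm ht).hasDerivWithinAt i hx

theorem sum {ι : Type*} (S : Finset ι) {m : ℕ} {G : ι → ℝ → (Fin d → ℝ) → ℝ}
    (hG : ∀ k ∈ S, JointCm d m (G k)) : JointCm d m (fun t x => ∑ k ∈ S, G k t x) := by
  induction m generalizing G with
  | zero => exact continuousOn_finsetSum _ hG
  | succ m ih =>
    exact of_hasDerivWithinAt (continuousOn_finsetSum _ fun k hk => (hG k hk).continuousOn)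
      (fun i => ih fun k hk => ((hG k hk).2 i).2)
      fun i t ht x hx => HasDerivWithinAt.fun_sum fun k hk => (hG k hk).hasDerivWithinAt i ht hx

theorem add {m : ℕ} {G H : ℝ → (Fin d → ℝ) → ℝ} (hG : JointCm d m G) (hH : JointCm d m H) :
    JointCm d m (fun t x => G t x + H t x) := by
  have h := sum Finset.univ (G := ![G, H]) (m := m) (by simp [Fin.forall_fin_two, hG, hH])
  simpa using h

theorem mul {m : ℕ} {G H : ℝ → (Fin d → ℝ) → ℝ} (hG : JointCm d m G) (hH : JointCm d m H) :
    JointCm d m (fun t x => G t x * H t x) := by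
  induction m generalizing G H with
  | zero => exact ContinuousOn.mul hG hH
  | succ m ih =>
    refine of_hasDerivWithinAt (G' := fun i t x => pd d i (G t) x * H t x + G t x * pd d i (H t) x)
      (hG.continuousOn.mul hH.continuousOn)
      (fun i => (ih (hG.2 i).2 hH.of_succ).add (ih hG.of_succ (hH.2 i).2)) fun i t ht x hx => ?_
    simpa using (hG.hasDerivWithinAt i ht hx).fun_mul (hH.hasDerivWithinAt i ht hx)

theorem comp {m : ℕ} {g : (Fin d → ℝ) → ℝ} (hg : MemCm d m g) {y : ℝ → (Fin d → ℝ) → (Fin d → ℝ)}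
    (hy : ∀ k, JointCm d m (fun t x => y t x k))
    (hmaps : ∀ t ∈ Set.Ici (0:ℝ), ∀ x ∈ cube d, y t x ∈ cube d) :
    JointCm d m (fun t x => g (y t x)) := by
  have hcont {m : ℕ} {g : (Fin d → ℝ) → ℝ} (hg : MemCm d m g)
      (hy : ∀ k, JointCm d m (fun t x => y t x k)) : JointCm d 0 (fun t x => g (y t x)) :=
    hg.continuousOn.comp (f := fun q : ℝ × (Fin d → ℝ) => y q.1 q.2)
      (continuousOn_pi.2 fun k => (hy k).continuousOn) fun q hq => hmaps _ hq.1 _ hq.2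
  induction m generalizing g with
  | zero => exact hcont hg hy
  | succ m ih =>
    exact of_hasDerivWithinAt
      (G' := fun i t x => ∑ l, pd d l g (y t x) * pd d i (fun x => y t x l) x) (hcont hg hy)
      (fun i => sum _ fun l _ => (ih (hg.2 l).2 fun k => (hy k).of_succ).mul ((hy l).2 i).2)
      fun i t ht x hx => hg.hasDerivWithinAt_comp (fun k => (hy k).memCm ht) (hmaps t ht) i hx

theorem iterPd {m : ℕ} (L : List (Fin d)) {G : ℝ → (Fin d → ℝ) → ℝ}
    (hG : JointCm d (m + L.length) G) : JointCm d m (fun t => iterPd d L (G t)) := by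
  induction L generalizing m with
  | nil => exact hG
  | cons i L ih =>
    refine ((ih (m := m + 1) ?_).2 i).2
    rwa [List.length_cons, ← add_assoc, add_right_comm] at hG

/-- Differentiation under the integral sign, up to the boundary of the cube. -/
theorem hasDerivWithinAt_integral {m : ℕ} {G : ℝ → (Fin d → ℝ) → ℝ} (hG : JointCm d (m + 1) G)
    (j : Fin d) {t : ℝ} (ht : 0 ≤ t) {x : Fin d → ℝ} (hx : x ∈ cube d) :
    HasDerivWithinAt (fun τ => ∫ s in (0:ℝ)..t, G s (Function.update x j τ))
      (∫ s in (0:ℝ)..t, pd d j (G s) x) (Set.Icc (0:ℝ) 1) (x j) := by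
  have hint {z : Fin d → ℝ} (hz : z ∈ cube d) :
      IntervalIntegrable (fun s => G s z) volume 0 t := by
    refine ((hG.continuousOn_time hz).mono fun s hs => ?_).intervalIntegrable
    rw [Set.uIcc_of_le ht] at hs
    exact hs.1
  obtain ⟨C, hC⟩ := ((isCompact_Icc (a := (0:ℝ)) (b := t)).prod
    (isCompact_cube (d := d))).exists_bound_of_continuousOn
    ((hG.2 j).2.continuousOn.mono (Set.prod_mono_left fun s hs => hs.1))
  rw [hasDerivWithinAt_iff_tendsto_slope]
  have hev : ∀ᶠ τ in nhdsWithin (x j) (Set.Icc (0:ℝ) 1 \ {x j}),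
      τ ∈ Set.Icc (0:ℝ) 1 ∧ τ ≠ x j := self_mem_nhdsWithin
  have hslope : ∀ᶠ τ in nhdsWithin (x j) (Set.Icc (0:ℝ) 1 \ {x j}),
      ∫ s in (0:ℝ)..t, slope (fun τ => G s (Function.update x j τ)) (x j) τ =
        slope (fun τ => ∫ s in (0:ℝ)..t, G s (Function.update x j τ)) (x j) τ := by
    filter_upwards [hev] with τ hτ
    simp only [slope_def_field]
    rw [intervalIntegral.integral_div, intervalIntegral.integral_sub
      (hint (update_mem_cube hx j hτ.1)) (hint (update_mem_cube hx j (apply_mem_Icc hx j)))]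
  refine Tendsto.congr' hslope
    (intervalIntegral.tendsto_integral_filter_of_dominated_convergence (fun _ => C) ?_ ?_ ?_ ?_)
  · filter_upwards [hev] with τ hτ
    simp only [slope_def_field]
    have h := ((hint (update_mem_cube hx j hτ.1)).sub
      (hint (update_mem_cube hx j (apply_mem_Icc hx j)))).div_const (τ - x j)
    exact h.aestronglyMeasurable_restrict_uIoc
  · filter_upwards [hev] with τ hτ
    refine Eventually.of_forall fun s hs => ?_
    rw [Set.uIoc_of_le ht] at hs
    have h := Convex.norm_image_sub_le_of_norm_hasDerivWithin_le (s := Set.Icc (0:ℝ) 1)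
      (f := fun τ => G s (Function.update x j τ))
      (f' := fun τ => pd d j (G s) (Function.update x j τ)) (C := C) ?_ ?_
      (convex_Icc 0 1) (apply_mem_Icc hx j) hτ.1
    · rw [slope_def_field, norm_div]
      exact div_le_of_le_mul₀ (norm_nonneg _) ((norm_nonneg _).trans
        (hC (s, x) ⟨Set.Ioc_subset_Icc_self hs, hx⟩)) h
    · intro σ hσ
      simpa using hG.hasDerivWithinAt j hs.1.le (update_mem_cube hx j hσ)
    · intro σ hσ
      exact hC (s, _) ⟨Set.Ioc_subset_Icc_self hs, update_mem_cube hx j hσ⟩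
  · exact intervalIntegrable_const
  · refine Eventually.of_forall fun s hs => ?_
    rw [Set.uIoc_of_le ht] at hs
    exact hasDerivWithinAt_iff_tendsto_slope.1 (hG.hasDerivWithinAt j hs.1.le hx)

theorem iterPd_add_integral (L : List (Fin d)) {H : ℝ → (Fin d → ℝ) → ℝ}
    (hH : JointCm d L.length H) {u g : (Fin d → ℝ) → ℝ} (hg : MemCm d L.length g) {t : ℝ}
    (ht : 0 ≤ t) (h : Set.EqOn u (fun x => g x + ∫ s in (0:ℝ)..t, H s x) (cube d)) :
    Set.EqOn (_root_.iterPd d L u)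
      (fun x => _root_.iterPd d L g x + ∫ s in (0:ℝ)..t, _root_.iterPd d L (H s) x) (cube d) := by
  induction L with
  | nil => exact h
  | cons j L ih =>
    intro x hx
    refine ((ih hH.of_succ hg.of_succ).pd j hx).trans (pd_eq_of_hasDerivWithinAt hx ?_)
    refine HasDerivWithinAt.add (MemCm.hasDerivWithinAt (m := 0) ?_ j hx)
      (hasDerivWithinAt_integral (m := 0) ?_ j ht hx)
    · exact MemCm.iterPd L (by rwa [zero_add, add_comm])
    · exact JointCm.iterPd L (by rwa [zero_add, add_comm])

end JointCm

end JointCm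
section ChainRule

variable {d : ℕ}

theorem MemCm.jointCm {m : ℕ} {f : (Fin d → ℝ) → ℝ} (hf : MemCm d m f) :
    JointCm d m (fun _ => f) := by
  have hcont {f : (Fin d → ℝ) → ℝ} (hf : ContinuousOn f (cube d)) :
      JointCm d 0 (fun _ => f) := hf.comp continuousOn_snd fun _ hq => hq.2
  induction m generalizing f with
  | zero => exact hcont hf
  | succ m ih =>
    exact ⟨hcont hf.continuousOn, fun i => ⟨fun _ _ => (hf.2 i).1, ih (hf.2 i).2⟩⟩

theorem MemCm.comp {m : ℕ} {g : (Fin d → ℝ) → ℝ} (hg : MemCm d m g)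
    {φ : (Fin d → ℝ) → (Fin d → ℝ)} (hφ : ∀ k, MemCm d m (fun x => φ x k))
    (hmaps : ∀ x ∈ cube d, φ x ∈ cube d) : MemCm d m (fun x => g (φ x)) :=
  (JointCm.comp hg (y := fun _ => φ) (fun k => (hφ k).jointCm) fun _ _ => hmaps).memCm le_rfl

theorem MemCm.pd_pd_comp {g : (Fin d → ℝ) → ℝ} (hg : MemCm d 2 g)
    {φ : (Fin d → ℝ) → (Fin d → ℝ)} (hφ : ∀ k, MemCm d 2 (fun x => φ x k))
    (hmaps : ∀ x ∈ cube d, φ x ∈ cube d) (k j : Fin d) :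
    Set.EqOn (pd d k (pd d j (fun x => g (φ x))))
      (fun x => ∑ l, (pd d k (fun x => pd d l g (φ x)) x * pd d j (fun x => φ x l) x +
        pd d l g (φ x) * pd d k (pd d j (fun x => φ x l)) x)) (cube d) := by
  intro x hx
  rw [(hg.pd_comp hφ hmaps j).pd k hx]
  refine pd_eq_of_hasDerivWithinAt hx (HasDerivWithinAt.fun_sum fun l _ => ?_)
  have h1 : MemCm d 1 (fun x => pd d l g (φ x)) :=
    MemCm.comp (hg.2 l).2 (fun k => (hφ k).of_succ) hmaps
  simpa using (h1.hasDerivWithinAt k hx).fun_mul (((hφ l).2 j).2.hasDerivWithinAt k hx)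

theorem MemCm.pd_pd_pd_comp {g : (Fin d → ℝ) → ℝ} (hg : MemCm d 3 g)
    {φ : (Fin d → ℝ) → (Fin d → ℝ)} (hφ : ∀ k, MemCm d 3 (fun x => φ x k))
    (hmaps : ∀ x ∈ cube d, φ x ∈ cube d) (p k j : Fin d) :
    Set.EqOn (pd d p (pd d k (pd d j (fun x => g (φ x)))))
      (fun x => ∑ l,
        ((pd d p (pd d k (fun x => pd d l g (φ x))) x * pd d j (fun x => φ x l) x +
          pd d k (fun x => pd d l g (φ x)) x * pd d p (pd d j (fun x => φ x l)) x) +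
        (pd d p (fun x => pd d l g (φ x)) x * pd d k (pd d j (fun x => φ x l)) x +
          pd d l g (φ x) * pd d p (pd d k (pd d j (fun x => φ x l))) x))) (cube d) := by
  intro x hx
  rw [(hg.of_succ.pd_pd_comp (fun k => (hφ k).of_succ) hmaps k j).pd p hx]
  refine pd_eq_of_hasDerivWithinAt hx (HasDerivWithinAt.fun_sum fun l _ => ?_)
  have h1 : MemCm d 2 (fun x => pd d l g (φ x)) :=
    MemCm.comp (hg.2 l).2 (fun k => (hφ k).of_succ) hmaps
  have h2 := ((hφ l).2 j).2
  simpa using (((h1.2 k).2.hasDerivWithinAt p hx).fun_mul (h2.hasDerivWithinAt p hx)).fun_add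
    ((h1.hasDerivWithinAt p hx).fun_mul ((h2.2 k).2.hasDerivWithinAt p hx))

theorem sum_abs_sum_mul_le {ι κ : Type*} [Fintype ι] [Fintype κ] {A : ι → κ → ℝ} {v : κ → ℝ}
    {C V : ℝ} (hC : 0 ≤ C) (hA : ∀ l, ∑ i, |A i l| ≤ C) (hv : ∑ l, |v l| ≤ V) :
    ∑ i, |∑ l, A i l * v l| ≤ C * V :=
  calc ∑ i, |∑ l, A i l * v l| ≤ ∑ i, ∑ l, |A i l| * |v l| := by
        gcongr with i
        exact (Finset.abs_sum_le_sum_abs _ _).trans_eq (by simp only [abs_mul])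
    _ = ∑ l, (∑ i, |A i l|) * |v l| := by
        rw [Finset.sum_comm]
        simp only [Finset.sum_mul]
    _ ≤ ∑ l, C * |v l| := by
        gcongr with l
        exact hA l
    _ ≤ C * V := by
        rw [← Finset.mul_sum]
        gcongr

theorem sum_abs_add_le {ι : Type*} [Fintype ι] {u v : ι → ℝ} {a b : ℝ} (hu : ∑ i, |u i| ≤ a)
    (hv : ∑ i, |v i| ≤ b) : ∑ i, |u i + v i| ≤ a + b :=
  (Finset.sum_le_sum fun i _ => abs_add_le (u i) (v i)).trans
    (Finset.sum_add_distrib.trans_le (add_le_add hu hv))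

variable {ι : Type*} [Fintype ι] {g : ι → (Fin d → ℝ) → ℝ} {φ : (Fin d → ℝ) → (Fin d → ℝ)}
  {x : Fin d → ℝ} {C V W U : ℝ}

theorem sum_abs_pd_comp_le (hg : ∀ i, MemCm d 1 (g i)) (hφ : ∀ k, MemCm d 1 (fun x => φ x k))
    (hmaps : ∀ x ∈ cube d, φ x ∈ cube d) (hx : x ∈ cube d) (hC : 0 ≤ C)
    (h1 : ∀ l, ∑ i, |pd d l (g i) (φ x)| ≤ C) (j : Fin d)
    (hV : ∑ l, |pd d j (fun x => φ x l) x| ≤ V) :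
    ∑ i, |pd d j (fun x => g i (φ x)) x| ≤ C * V := by
  simp only [fun i => (hg i).pd_comp hφ hmaps j hx]
  exact sum_abs_sum_mul_le hC h1 hV

theorem sum_abs_pd_pd_comp_le (hg : ∀ i, MemCm d 2 (g i)) (hφ : ∀ k, MemCm d 2 (fun x => φ x k))
    (hmaps : ∀ x ∈ cube d, φ x ∈ cube d) (hx : x ∈ cube d) (hC : 0 ≤ C)
    (h1 : ∀ l, ∑ i, |pd d l (g i) (φ x)| ≤ C)
    (h2 : ∀ m l, ∑ i, |pd d m (pd d l (g i)) (φ x)| ≤ C)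
    (hV : ∀ j, ∑ l, |pd d j (fun x => φ x l) x| ≤ V) (k j : Fin d)
    (hW : ∑ l, |pd d k (pd d j (fun x => φ x l)) x| ≤ W) :
    ∑ i, |pd d k (pd d j (fun x => g i (φ x))) x| ≤ C * V * V + C * W := by
  have hV₀ : 0 ≤ V := (Finset.sum_nonneg fun _ _ => abs_nonneg _).trans (hV j)
  simp only [fun i => (hg i).pd_pd_comp hφ hmaps k j hx, Finset.sum_add_distrib]
  refine sum_abs_add_le (sum_abs_sum_mul_le (by positivity) (fun l => ?_) (hV j))
    (sum_abs_sum_mul_le hC h1 hW)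
  exact sum_abs_pd_comp_le (fun i => ((hg i).2 l).2) (fun k => (hφ k).of_succ) hmaps hx hC
    (fun m => h2 m l) k (hV k)

theorem sum_abs_pd_pd_pd_comp_le (hg : ∀ i, MemCm d 3 (g i))
    (hφ : ∀ k, MemCm d 3 (fun x => φ x k))
    (hmaps : ∀ x ∈ cube d, φ x ∈ cube d) (hx : x ∈ cube d) (hC : 0 ≤ C)
    (h1 : ∀ l, ∑ i, |pd d l (g i) (φ x)| ≤ C)
    (h2 : ∀ m l, ∑ i, |pd d m (pd d l (g i)) (φ x)| ≤ C)
    (h3 : ∀ n m l, ∑ i, |pd d n (pd d m (pd d l (g i))) (φ x)| ≤ C)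
    (hV : ∀ j, ∑ l, |pd d j (fun x => φ x l) x| ≤ V)
    (hW : ∀ k j, ∑ l, |pd d k (pd d j (fun x => φ x l)) x| ≤ W) (p k j : Fin d)
    (hU : ∑ l, |pd d p (pd d k (pd d j (fun x => φ x l))) x| ≤ U) :
    ∑ i, |pd d p (pd d k (pd d j (fun x => g i (φ x)))) x| ≤
      ((C * V * V + C * W) * V + C * V * W) + (C * V * W + C * U) := by
  have hV₀ : 0 ≤ V := (Finset.sum_nonneg fun _ _ => abs_nonneg _).trans (hV j)
  have hW₀ : 0 ≤ W := (Finset.sum_nonneg fun _ _ => abs_nonneg _).trans (hW k j)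
  have hfirst (k l : Fin d) : ∑ i, |pd d k (fun x => pd d l (g i) (φ x)) x| ≤ C * V :=
    sum_abs_pd_comp_le (fun i => ((hg i).2 l).2.of_succ) (fun k => (hφ k).of_succ.of_succ) hmaps hx
      hC (fun m => h2 m l) k (hV k)
  simp only [fun i => (hg i).pd_pd_pd_comp hφ hmaps p k j hx, Finset.sum_add_distrib]
  refine sum_abs_add_le
    (sum_abs_add_le (sum_abs_sum_mul_le (by positivity) (fun l => ?_) (hV j))
      (sum_abs_sum_mul_le (by positivity) (hfirst k) (hW p j)))
    (sum_abs_add_le (sum_abs_sum_mul_le (by positivity) (hfirst p) (hW k j))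
      (sum_abs_sum_mul_le hC h1 hU))
  exact sum_abs_pd_pd_comp_le (fun i => ((hg i).2 l).2) (fun k => (hφ k).of_succ) hmaps hx hC
    (fun m => h2 m l) (fun n m => h3 n m l) hV p k (hW p k)

end ChainRule

section Flow

theorem aestronglyMeasurable_primitive (g : ℝ → ℝ) :
    AEStronglyMeasurable (fun t => ∫ s in (0:ℝ)..t, g s) (volume.restrict (Set.Ici 0)) := by
  set S : Set ℝ := {t | 0 ≤ t ∧ IntervalIntegrable g volume 0 t} with hS
  have hdown {s t : ℝ} (ht : t ∈ S) (hs : 0 ≤ s) (hst : s ≤ t) : s ∈ S :=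
    ⟨hs, ht.2.mono_set (by rw [Set.uIcc_of_le hs, Set.uIcc_of_le ht.1]; gcongr)⟩
  have hmeas : MeasurableSet S :=
    Set.OrdConnected.measurableSet ⟨fun a ha c hc s hs => hdown hc (ha.1.trans hs.1) hs.2⟩
  have hprim {t : ℝ} (ht : t ∈ S) :
      ContinuousOn (fun t => ∫ s in (0:ℝ)..t, g s) (Set.Icc 0 t) := by
    simpa [Set.uIcc_of_le ht.1] using
      intervalIntegral.continuousOn_primitive_interval' ht.2 Set.left_mem_uIcc
  have hcont : ContinuousOn (fun t => ∫ s in (0:ℝ)..t, g s) S := by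
    intro t ht
    by_cases hmax : ∃ u ∈ S, t < u
    · obtain ⟨u, hu, htu⟩ := hmax
      refine (hprim hu t ⟨ht.1, htu.le⟩).mono_of_mem_nhdsWithin ?_
      filter_upwards [self_mem_nhdsWithin, mem_nhdsWithin_of_mem_nhds (Iio_mem_nhds htu)]
        with s hs hsu using ⟨hs.1, le_of_lt hsu⟩
    · push Not at hmax
      exact (hprim ht t ⟨ht.1, le_rfl⟩).mono fun s hs => ⟨hs.1, hmax s hs⟩
  have hind : AEStronglyMeasurable (S.indicator fun t => ∫ s in (0:ℝ)..t, g s) volume :=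
    (aestronglyMeasurable_indicator_iff hmeas).2 (hcont.aestronglyMeasurable hmeas)
  refine hind.restrict.congr ?_
  filter_upwards [ae_restrict_mem measurableSet_Ici] with t ht
  by_cases h : t ∈ S
  · simp [h]
  · rw [Set.indicator_of_notMem h, intervalIntegral.integral_undef fun h' => h ⟨ht, h'⟩]

theorem sum_abs_le_of_integral_eq {d : ℕ} {q r : Fin d → ℝ → ℝ} {q₀ : Fin d → ℝ} {K c t : ℝ}
    (ht : 0 ≤ t) (hr : ∀ i, ContinuousOn (r i) (Set.Ici 0))
    (hq : ∀ i, ∀ s, 0 ≤ s → q i s = q₀ i + ∫ τ in (0:ℝ)..s, r i τ)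
    (hle : ∀ s ∈ Set.Icc 0 t, ∑ i, |r i s| ≤ K * ∑ i, |q i s| + K * c) :
    ∑ i, |q i t| ≤ (∑ i, |q₀ i|) * Real.exp (K * t) + c * (Real.exp (K * t) - 1) := by
  have hderiv : ∀ s ∈ Set.Ici (0:ℝ), ∀ i, HasDerivWithinAt (q i) (r i s) (Set.Ici s) s := by
    intro s hs i
    have hint : IntervalIntegrable (r i) volume 0 s :=
      ((hr i).mono fun τ hτ => by rw [Set.uIcc_of_le hs] at hτ; exact hτ.1).intervalIntegrable
    have hsub : Set.Ioi s ⊆ Set.Ici 0 := fun τ hτ => le_trans (Set.mem_Ici.1 hs) (le_of_lt hτ)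
    have h := intervalIntegral.integral_hasDerivWithinAt_right (s := Set.Ici s) (t := Set.Ioi s)
      hint ((hr i).mono hsub |>.stronglyMeasurableAtFilter_nhdsWithin measurableSet_Ioi s)
      ((hr i s hs).mono hsub)
    exact (h.const_add (q₀ i)).congr (fun τ hτ => hq i τ (le_trans hs hτ)) (hq i s hs)
  have hcont : ∀ i, ContinuousOn (q i) (Set.Icc 0 t) := by
    intro i
    have hint : IntervalIntegrable (r i) volume 0 t :=
      ((hr i).mono fun τ hτ => by rw [Set.uIcc_of_le ht] at hτ; exact hτ.1).intervalIntegrable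
    have h := intervalIntegral.continuousOn_primitive_interval' hint Set.left_mem_uIcc
    rw [Set.uIcc_of_le ht] at h
    exact (h.const_add (q₀ i)).congr fun τ hτ => hq i τ hτ.1
  have hnorm (v : Fin d → ℝ) : ‖WithLp.toLp 1 v‖ = ∑ i, |v i| := by
    simp [PiLp.norm_eq_of_L1]
  have hgr := norm_le_gronwallBound_of_norm_deriv_right_le (a := 0) (b := t) (K := K) (ε := K * c)
    (f := fun s => WithLp.toLp 1 (fun i => q i s)) (f' := fun s => WithLp.toLp 1 (fun i => r i s))
    (δ := ∑ i, |q₀ i|)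
    ((PiLp.continuous_toLp 1 _).comp_continuousOn (continuousOn_pi.2 hcont))
    (fun s hs => HasFDerivAt.comp_hasDerivWithinAt s
      (PiLp.hasFDerivAt_toLp (𝕜 := ℝ) 1 (fun i => q i s)) (hasDerivWithinAt_pi.2 (hderiv s hs.1)))
    (by simp [hnorm, hq _ 0 le_rfl])
    (fun s hs => by simpa only [hnorm] using hle s (Set.Ico_subset_Icc_self hs)) t ⟨ht, le_rfl⟩
  rw [hnorm, sub_zero] at hgr
  refine hgr.trans_eq ?_
  by_cases hK : K = 0
  · simp [gronwallBound, hK]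
  · rw [gronwallBound_of_K_ne_0 hK, mul_div_cancel_left₀ _ hK]

variable {d : ℕ} {b : Fin d → (Fin d → ℝ) → ℝ} {y : ℝ → (Fin d → ℝ) → (Fin d → ℝ)}

theorem intervalIntegrable_drift_flow
    (hb : ∀ i, ContinuousOn (b i) (cube d))
    (hmaps : ∀ t ∈ Set.Ici (0:ℝ), ∀ x ∈ cube d, y t x ∈ cube d)
    (hflow : ∀ i : Fin d, ∀ t ∈ Set.Ici (0:ℝ), ∀ x ∈ cube d,
      y t x i = x i + ∫ s in (0:ℝ)..t, b i (y s x))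
    (i : Fin d) {t : ℝ} (ht : 0 ≤ t) {x : Fin d → ℝ} (hx : x ∈ cube d) :
    IntervalIntegrable (fun s => b i (y s x)) volume 0 t := by
  have hy : AEMeasurable (fun s => y s x) (volume.restrict (Set.Ici 0)) := by
    refine aemeasurable_pi_lambda _ fun k => ?_
    refine ((aestronglyMeasurable_primitive fun s => b k (y s x)).aemeasurable.const_add
      (x k)).congr ?_
    filter_upwards [ae_restrict_mem measurableSet_Ici] with s hs using (hflow k s hs x hx).symm
  have hcube : MeasurableSet (cube d) := isCompact_cube.isClosed.measurableSet
  have hbm : Measurable ((cube d).indicator (b i)) := by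
    classical
    rw [← Set.piecewise_eq_indicator]
    exact (hb i).measurable_piecewise continuousOn_const hcube
  have hcomp : AEMeasurable (fun s => b i (y s x)) (volume.restrict (Set.Ici 0)) := by
    refine (hbm.comp_aemeasurable hy).congr ?_
    filter_upwards [ae_restrict_mem measurableSet_Ici] with s hs
    exact Set.indicator_of_mem (hmaps s hs x hx) _
  obtain ⟨M, hM⟩ := isCompact_cube.exists_bound_of_continuousOn (hb i)
  have hsub : Set.uIoc 0 t ⊆ Set.Ici 0 := by
    rw [Set.uIoc_of_le ht]
    exact fun s hs => hs.1.le
  refine (intervalIntegrable_const (c := M)).mono_fun'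
    (hcomp.mono_measure (Measure.restrict_mono hsub le_rfl)).aestronglyMeasurable ?_
  filter_upwards [ae_restrict_mem measurableSet_uIoc] with s hs
  exact hM _ (hmaps s (hsub hs) x hx)

theorem continuousOn_flow
    (hb : ∀ i, ContinuousOn (b i) (cube d))
    (hmaps : ∀ t ∈ Set.Ici (0:ℝ), ∀ x ∈ cube d, y t x ∈ cube d)
    (hflow : ∀ i : Fin d, ∀ t ∈ Set.Ici (0:ℝ), ∀ x ∈ cube d,
      y t x i = x i + ∫ s in (0:ℝ)..t, b i (y s x))
    (hspace : ∀ t ∈ Set.Ici (0:ℝ), ∀ i, ContinuousOn (fun x => y t x i) (cube d)) (i : Fin d) :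
    ContinuousOn (fun q : ℝ × (Fin d → ℝ) => y q.1 q.2 i) (Set.Ici (0:ℝ) ×ˢ cube d) := by
  obtain ⟨M, hM⟩ := isCompact_cube.exists_bound_of_continuousOn (hb i)
  have hM₀ : 0 ≤ M := (norm_nonneg _).trans (hM 0 zero_mem_cube)
  refine continuousOn_prod_of_continuousOn_lipschitzOnWith _ M.toNNReal
    (fun t ht => hspace t ht i) fun x hx => LipschitzOnWith.of_dist_le_mul fun t ht s hs => ?_
  have hint {t : ℝ} (ht : t ∈ Set.Ici (0:ℝ)) := intervalIntegrable_drift_flow hb hmaps hflow i ht hx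
  rw [Real.coe_toNNReal _ hM₀, Real.dist_eq, Real.dist_eq, hflow i t ht x hx, hflow i s hs x hx,
    add_sub_add_left_eq_sub, intervalIntegral.integral_interval_sub_left (hint ht) (hint hs)]
  refine intervalIntegral.norm_integral_le_of_norm_le_const (E := ℝ) fun τ hτ => ?_
  exact hM _ (hmaps τ (le_trans (le_min hs ht) hτ.1.le) x hx)

/-- `y` is a flow of the `C³` vector field `b` on the cube, `C³` in space with jointly continuous
derivatives. -/
structure IsC3Flow (b : Fin d → (Fin d → ℝ) → ℝ) (y : ℝ → (Fin d → ℝ) → (Fin d → ℝ)) : Prop where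
  memCm_drift : ∀ i, MemCm d 3 (b i)
  jointCm : ∀ i, JointCm d 3 (fun t x => y t x i)
  mapsTo : ∀ t ∈ Set.Ici (0:ℝ), ∀ x ∈ cube d, y t x ∈ cube d
  apply_eq : ∀ i : Fin d, ∀ t ∈ Set.Ici (0:ℝ), ∀ x ∈ cube d,
    y t x i = x i + ∫ s in (0:ℝ)..t, b i (y s x)

namespace IsC3Flow

theorem sum_abs_iterPd_le (hy : IsC3Flow b y) {t : ℝ} (ht : 0 ≤ t) {x : Fin d → ℝ}
    (hx : x ∈ cube d) {L : List (Fin d)} (hL : L.length ≤ 3) {K c : ℝ}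
    (hle : ∀ s ∈ Set.Icc 0 t, ∑ i, |iterPd d L (fun x => b i (y s x)) x| ≤
      K * ∑ i, |iterPd d L (fun x => y s x i) x| + K * c) :
    ∑ i, |iterPd d L (fun x => y t x i) x| ≤
      (∑ i, |iterPd d L (fun x => x i) x|) * Real.exp (K * t) + c * (Real.exp (K * t) - 1) := by
  have hby (i : Fin d) : JointCm d L.length (fun s x => b i (y s x)) :=
    (JointCm.comp (hy.memCm_drift i) hy.jointCm hy.mapsTo).mono hL
  refine sum_abs_le_of_integral_eq (q := fun i s => iterPd d L (fun x => y s x i) x)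
    (r := fun i s => iterPd d L (fun x => b i (y s x)) x) ht (fun i => ?_) (fun i s hs => ?_) hle
  · exact (JointCm.iterPd (m := 0) L (by rw [zero_add]; exact hby i)).continuousOn_time hx
  · exact JointCm.iterPd_add_integral L (hby i) (memCm_apply _ i) hs
      (fun z hz => hy.apply_eq i s hs z hz) hx

theorem sum_abs_pd_le (hy : IsC3Flow b y) {t : ℝ} (ht : 0 ≤ t) {x : Fin d → ℝ}
    (hx : x ∈ cube d) (j : Fin d) :
    ∑ i, |pd d j (fun x => y t x i) x| ≤ Real.exp (lamNorm d 3 b * t) := by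
  have h := hy.sum_abs_iterPd_le ht hx (L := [j]) (by simp)
    (K := lamNorm d 3 b) (c := 0) fun s hs => by
      have h := sum_abs_pd_comp_le (fun i => (hy.memCm_drift i).mono (by norm_num))
        (fun k => ((hy.jointCm k).memCm hs.1).mono (by norm_num)) (hy.mapsTo s hs.1) hx
        (lamNorm_nonneg 3 b)
        (fun l => sum_abs_iterPd_le_lamNorm (L := [l]) (by simp) (by simp) hy.memCm_drift
          (hy.mapsTo s hs.1 x hx))
        j le_rfl
      rw [mul_zero, add_zero]
      exact h
  refine h.trans_eq ?_
  have h0 (i : Fin d) : iterPd d [j] (fun x => x i) x = if i = j then 1 else 0 :=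
    eqOn_pd_apply i j hx
  simp [h0, apply_ite]

theorem sum_abs_pd_pd_le (hy : IsC3Flow b y) {t : ℝ} (ht : 0 ≤ t) {x : Fin d → ℝ}
    (hx : x ∈ cube d) (k j : Fin d) :
    ∑ i, |pd d k (pd d j (fun x => y t x i)) x| ≤
      Real.exp (lamNorm d 3 b * t) ^ 2 * (Real.exp (lamNorm d 3 b * t) - 1) := by
  set z := Real.exp (lamNorm d 3 b * t) with hz
  have h := hy.sum_abs_iterPd_le ht hx (L := [k, j]) (by simp)
    (K := lamNorm d 3 b) (c := z ^ 2) fun s hs => by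
      have hle : Real.exp (lamNorm d 3 b * s) ≤ z :=
        Real.exp_le_exp.2 (mul_le_mul_of_nonneg_left hs.2 (lamNorm_nonneg 3 b))
      have h := sum_abs_pd_pd_comp_le (fun i => (hy.memCm_drift i).mono (by norm_num))
        (fun k => ((hy.jointCm k).memCm hs.1).mono (by norm_num)) (hy.mapsTo s hs.1) hx
        (lamNorm_nonneg 3 b)
        (fun l => sum_abs_iterPd_le_lamNorm (L := [l]) (by simp) (by simp) hy.memCm_drift
          (hy.mapsTo s hs.1 x hx))
        (fun m l => sum_abs_iterPd_le_lamNorm (L := [m, l]) (by simp) (by simp) hy.memCm_drift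
          (hy.mapsTo s hs.1 x hx))
        (fun j => (hy.sum_abs_pd_le hs.1 hx j).trans hle) k j le_rfl
      refine h.trans_eq ?_
      simp only [iterPd, List.foldr_cons, List.foldr_nil]
      ring
  refine h.trans_eq ?_
  have h0 (i : Fin d) : iterPd d [k, j] (fun x => x i) x = 0 := by
    refine ((eqOn_pd_apply i j).pd k hx).trans ?_
    rw [pd_const]
  simp [h0, hz]

theorem sum_abs_pd_pd_pd_le (hy : IsC3Flow b y) {t : ℝ} (ht : 0 ≤ t) {x : Fin d → ℝ}
    (hx : x ∈ cube d) (p k j : Fin d) :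
    ∑ i, |pd d p (pd d k (pd d j (fun x => y t x i))) x| ≤
      (3 * Real.exp (lamNorm d 3 b * t) ^ 4 - 2 * Real.exp (lamNorm d 3 b * t) ^ 3) *
        (Real.exp (lamNorm d 3 b * t) - 1) := by
  set z := Real.exp (lamNorm d 3 b * t) with hz
  have h := hy.sum_abs_iterPd_le ht hx (L := [p, k, j]) (by simp)
    (K := lamNorm d 3 b) (c := 3 * z ^ 4 - 2 * z ^ 3) fun s hs => by
      have hle : Real.exp (lamNorm d 3 b * s) ≤ z :=
        Real.exp_le_exp.2 (mul_le_mul_of_nonneg_left hs.2 (lamNorm_nonneg 3 b))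
      have hone : 1 ≤ Real.exp (lamNorm d 3 b * s) :=
        Real.one_le_exp (mul_nonneg (lamNorm_nonneg 3 b) hs.1)
      have h := sum_abs_pd_pd_pd_comp_le hy.memCm_drift
        (fun k => (hy.jointCm k).memCm hs.1) (hy.mapsTo s hs.1) hx
        (lamNorm_nonneg 3 b)
        (fun l => sum_abs_iterPd_le_lamNorm (L := [l]) (by simp) (by simp) hy.memCm_drift
          (hy.mapsTo s hs.1 x hx))
        (fun m l => sum_abs_iterPd_le_lamNorm (L := [m, l]) (by simp) (by simp) hy.memCm_drift
          (hy.mapsTo s hs.1 x hx))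
        (fun n m l => sum_abs_iterPd_le_lamNorm (L := [n, m, l]) (by simp) (by simp) hy.memCm_drift
          (hy.mapsTo s hs.1 x hx))
        (fun j => (hy.sum_abs_pd_le hs.1 hx j).trans hle)
        (W := z ^ 2 * (z - 1))
        (fun k j => (hy.sum_abs_pd_pd_le hs.1 hx k j).trans (by gcongr))
        p k j le_rfl
      refine h.trans_eq ?_
      simp only [iterPd, List.foldr_cons, List.foldr_nil]
      ring
  refine h.trans_eq ?_
  have h0 (i : Fin d) : iterPd d [p, k, j] (fun x => x i) x = 0 := by
    refine (((eqOn_pd_apply i j).pd k).pd p hx).trans ?_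
    rw [pd_const, pd_const]
  simp [h0, hz]

end IsC3Flow

end Flow
/-- `C³`-estimate for the drift semigroup `T¹_t f = f ∘ y(t,·)`:
if `f ∈ C³([0,1]^d,ℝ)` then `T¹_t f ∈ C³([0,1]^d,ℝ)` and
`‖T¹_t f‖_{C³} ≤ e^{13 λ₃ t} ‖f‖_{C³}`. -/
theorem drift_semigroup_C3_estimate
    (d : ℕ) (hd : 0 < d)
    (b : Fin d → (Fin d → ℝ) → ℝ)
    (hb : ∀ i : Fin d, MemCm d 3 (b i))
    (hbdry : ∀ i : Fin d, ∀ x ∈ cube d,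
      (x i = 0 → 0 ≤ b i x) ∧ (x i = 1 → b i x ≤ 0))
    (y : ℝ → (Fin d → ℝ) → (Fin d → ℝ))
    (hy_cube : ∀ t ∈ Set.Ici (0:ℝ), ∀ x ∈ cube d, y t x ∈ cube d)
    (hy_flow : ∀ i : Fin d, ∀ t ∈ Set.Ici (0:ℝ), ∀ x ∈ cube d,
      y t x i = x i + ∫ s in (0:ℝ)..t, b i (y s x))
    (hy_C3 : ∀ t ∈ Set.Ici (0:ℝ), ∀ i : Fin d, MemCm d 3 (fun x => y t x i))
    (hy_joint1 : ∀ i j : Fin d, ContinuousOn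
      (fun q : ℝ × (Fin d → ℝ) => pd d j (fun x => y q.1 x i) q.2)
      (Set.Ici (0:ℝ) ×ˢ cube d))
    (hy_joint2 : ∀ i j k : Fin d, ContinuousOn
      (fun q : ℝ × (Fin d → ℝ) => pd d k (pd d j (fun x => y q.1 x i)) q.2)
      (Set.Ici (0:ℝ) ×ˢ cube d))
    (hy_joint3 : ∀ i j k l : Fin d, ContinuousOn
      (fun q : ℝ × (Fin d → ℝ) => pd d l (pd d k (pd d j (fun x => y q.1 x i))) q.2)
      (Set.Ici (0:ℝ) ×ˢ cube d))
    (f : (Fin d → ℝ) → ℝ) (hf : MemCm d 3 f) (t : ℝ) (ht : 0 ≤ t) :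
    MemCm d 3 (fun x => f (y t x)) ∧
    CmNorm d 3 (fun x => f (y t x)) ≤ Real.exp (13 * lamNorm d 3 b * t) * CmNorm d 3 f := by
  have hy : IsC3Flow b y :=
    ⟨hb, fun i => ⟨continuousOn_flow (fun i => (hb i).continuousOn) hy_cube hy_flow
      (fun t ht i => (hy_C3 t ht i).continuousOn) i, fun j => ⟨fun t ht => ((hy_C3 t ht i).2 j).1,
      hy_joint1 i j, fun k => ⟨fun t ht => (((hy_C3 t ht i).2 j).2.2 k).1, hy_joint2 i j k,
      fun l => ⟨fun t ht => ((((hy_C3 t ht i).2 j).2.2 k).2.2 l).1, hy_joint3 i j k l⟩⟩⟩⟩,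
      hy_cube, hy_flow⟩
  refine ⟨(JointCm.comp hf hy.jointCm hy_cube).memCm ht, CmNorm_le fun L hL x hx => ?_⟩
  set z := Real.exp (lamNorm d 3 b * t) with hz
  set C := CmNorm d 3 f
  have hC₀ : 0 ≤ C := CmNorm_nonneg 3 f
  have hz₁ : 1 ≤ z := Real.one_le_exp (mul_nonneg (lamNorm_nonneg 3 b) ht)
  have hexp : Real.exp (13 * lamNorm d 3 b * t) = z ^ 13 := by
    rw [hz, ← Real.exp_nat_mul]
    congr 1
    push_cast
    ring
  have hφ (k : Fin d) := (hy.jointCm k).memCm ht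
  have hbound (L : List (Fin d)) (hL : L.length ≤ 3) :
      ∑ _i : Unit, |iterPd d L f (y t x)| ≤ C := by
    simpa using hf.abs_iterPd_le_CmNorm hL (hy_cube t ht x hx)
  have hV (j : Fin d) := hy.sum_abs_pd_le ht hx j
  have hW (k j : Fin d) := hy.sum_abs_pd_pd_le ht hx k j
  have hU (p k j : Fin d) := hy.sum_abs_pd_pd_pd_le ht hx p k j
  rw [hexp, mul_comm]
  match L, hL with
  | [], _ =>
    calc _ ≤ C := by simpa [iterPd] using hbound [] (by simp)
      _ ≤ C * z ^ 13 := le_mul_of_one_le_right hC₀ (one_le_pow₀ hz₁)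
  | [j], _ =>
    have h := sum_abs_pd_comp_le (fun _ : Unit => hf.mono (by norm_num))
      (fun k => (hφ k).mono (by norm_num)) (hy_cube t ht) hx hC₀
      (fun l => hbound [l] (by simp)) j (hV j)
    calc _ ≤ C * z := by simpa [iterPd, ← hz] using h
      _ ≤ C * z ^ 13 := by gcongr; exact le_self_pow₀ hz₁ (by norm_num)
  | [k, j], _ =>
    have h := sum_abs_pd_pd_comp_le (fun _ : Unit => hf.mono (by norm_num))
      (fun k => (hφ k).mono (by norm_num)) (hy_cube t ht) hx hC₀
      (fun l => hbound [l] (by simp)) (fun m l => hbound [m, l] (by simp)) hV k j (hW k j)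
    calc _ ≤ C * z * z + C * (z ^ 2 * (z - 1)) := by simpa [iterPd, ← hz] using h
      _ = C * z ^ 3 := by ring
      _ ≤ C * z ^ 13 := by gcongr; norm_num
  | [p, k, j], _ =>
    have h := sum_abs_pd_pd_pd_comp_le (fun _ : Unit => hf) hφ (hy_cube t ht) hx hC₀
      (fun l => hbound [l] (by simp)) (fun m l => hbound [m, l] (by simp))
      (fun n m l => hbound [n, m, l] (by simp)) hV hW p k j (hU p k j)
    have hcube : 3 * z - 2 ≤ z ^ 3 := by
      nlinarith [mul_nonneg (sq_nonneg (z - 1)) (by linarith : (0 : ℝ) ≤ z + 2)]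
    have hlin : 3 * z - 2 ≤ z ^ 9 := hcube.trans (pow_le_pow_right₀ hz₁ (by norm_num))
    have hle : |iterPd d [p, k, j] (fun x => f (y t x)) x| ≤
        ((C * z * z + C * (z ^ 2 * (z - 1))) * z + C * z * (z ^ 2 * (z - 1))) +
          (C * z * (z ^ 2 * (z - 1)) + C * ((3 * z ^ 4 - 2 * z ^ 3) * (z - 1))) := by
      simpa [iterPd, ← hz] using h
    calc _ ≤ _ := hle
      _ = C * (z ^ 4 * (3 * z - 2)) := by ring
      _ ≤ C * (z ^ 4 * z ^ 9) := by gcongr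
      _ = C * z ^ 13 := by ring

end
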